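/- arXiv:1312.1257 — 2 statements merged into one kernel-verified Lean document; each statement's English description precedes it below -/
import Mathlib

section
/- Let t > 0. Then for every ξ ∈ ℝ² with ξ ≠ 0, ∫_{{x ∈ ℝ² : |x| < t}} (1/(2π)) (t² − |x|²)^{−1/2} exp(−2πi⟨ξ,x⟩) dx = sin(2πt|ξ|) / (2π|ξ|), the integral being absolutely convergent. -/
open MeasureTheory Real

lemma inner_aux (r : ℝ) (hr : 0 < r) :
    IntegrableOn (fun b : ℝ => (r ^ 2 - b ^ 2) ^ (-(1 : ℝ) / 2)) (Set.Ioo (-r) r) ∧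
    ∫ b in Set.Ioo (-r) r, (r ^ 2 - b ^ 2) ^ (-(1 : ℝ) / 2) = π := by
  have hc : ContinuousOn (fun b : ℝ => arcsin (b / r)) (Set.Icc (-r) r) := by
    fun_prop
  have hd : ∀ b ∈ Set.Ioo (-r) r, HasDerivAt (fun b : ℝ => arcsin (b / r))
      ((r ^ 2 - b ^ 2) ^ (-(1 : ℝ) / 2)) b := by
    intro b hb
    have h1 : -1 < b / r := by rw [lt_div_iff₀ hr]; linarith [hb.1]
    have h2 : b / r < 1 := by rw [div_lt_iff₀ hr]; linarith [hb.2]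
    have h := (Real.hasDerivAt_arcsin h1.ne' h2.ne).comp b ((hasDerivAt_id b).div_const r)
    refine h.congr_deriv ?_
    have hp : 0 < r ^ 2 - b ^ 2 := by nlinarith [hb.1, hb.2]
    have e : 1 - (b / r) ^ 2 = (r ^ 2 - b ^ 2) / r ^ 2 := by field_simp
    rw [show (-(1 : ℝ) / 2) = -(1 / 2) by norm_num, Real.rpow_neg hp.le, ← Real.sqrt_eq_rpow]
    rw [e, Real.sqrt_div hp.le, Real.sqrt_sq hr.le]
    have := Real.sqrt_pos.2 hp
    field_simp
  have hi := intervalIntegral.integrableOn_deriv_of_nonneg hc hd (by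
    intro b hb
    apply Real.rpow_nonneg
    nlinarith [hb.1, hb.2])
  refine ⟨hi.mono_set Set.Ioo_subset_Ioc_self, ?_⟩
  rw [← integral_Ioc_eq_integral_Ioo, ← intervalIntegral.integral_of_le (by linarith),
    intervalIntegral.integral_eq_sub_of_hasDerivAt_of_le (by linarith) hc hd
      ((intervalIntegrable_iff_integrableOn_Ioc_of_le (by linarith)).2 hi)]
  rw [neg_div, div_self hr.ne', Real.arcsin_neg, Real.arcsin_one]; ring
noncomputable def gker (t : ℝ) (p : ℝ × ℝ) : ℝ :=
  Set.indicator {p : ℝ × ℝ | p.1 ^ 2 + p.2 ^ 2 < t ^ 2}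
    (fun p => 1 / (2 * π) * (t ^ 2 - (p.1 ^ 2 + p.2 ^ 2)) ^ (-(1 : ℝ) / 2)) p

lemma gker_slice (t : ℝ) (ht : 0 < t) (a : ℝ) : Integrable (fun b => gker t (a, b)) ∧
    ∫ b, gker t (a, b) = Set.indicator (Set.Ioo (-t) t) (fun _ => (1 / 2 : ℝ)) a := by
  by_cases ha : a ∈ Set.Ioo (-t) t
  · have hp : 0 < t ^ 2 - a ^ 2 := by nlinarith [ha.1, ha.2]
    have hr := Real.sqrt_pos.2 hp
    have hs := Real.sq_sqrt hp.le
    set r := √(t ^ 2 - a ^ 2)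
    obtain ⟨h1, h2⟩ := inner_aux r hr
    have e : (fun b => gker t (a, b)) = Set.indicator (Set.Ioo (-r) r)
        (fun b => 1 / (2 * π) * (r ^ 2 - b ^ 2) ^ (-(1 : ℝ) / 2)) := by
      ext b
      have : (a, b) ∈ {p : ℝ × ℝ | p.1 ^ 2 + p.2 ^ 2 < t ^ 2} ↔ b ∈ Set.Ioo (-r) r := by
        rw [Set.mem_Ioo, ← abs_lt, ← abs_of_pos hr, ← sq_lt_sq, hs]
        simp only [Set.mem_ofPred_eq]
        constructor <;> intro h <;> linarith
      unfold gker
      by_cases hb : b ∈ Set.Ioo (-r) r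
      · rw [Set.indicator_of_mem hb, Set.indicator_of_mem (this.2 hb), hs]
        simp only [sub_sub]
      · rw [Set.indicator_of_notMem hb, Set.indicator_of_notMem (fun h => hb (this.1 h))]
    rw [e]
    refine ⟨(integrable_indicator_iff measurableSet_Ioo).2 (h1.const_mul _), ?_⟩
    rw [integral_indicator measurableSet_Ioo, integral_const_mul, h2, Set.indicator_of_mem ha]
    field_simp
  · have e : (fun b => gker t (a, b)) = fun _ => 0 := by
      ext b
      apply Set.indicator_of_notMem
      intro h
      apply ha
      simp only [Set.mem_ofPred_eq] at h
      exact abs_lt.1 (abs_lt_of_sq_lt_sq (by nlinarith [sq_nonneg b]) ht.le)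
    rw [e, Set.indicator_of_notMem ha]
    simp

lemma gker_nonneg (t : ℝ) (p : ℝ × ℝ) : 0 ≤ gker t p := by
  unfold gker
  apply Set.indicator_nonneg
  intro p hp
  simp only [Set.mem_ofPred_eq] at hp
  have := Real.rpow_nonneg (x := t ^ 2 - (p.1 ^ 2 + p.2 ^ 2)) (by linarith) (-(1 : ℝ) / 2)
  positivity

lemma gker_meas (t : ℝ) : Measurable (gker t) := by
  unfold gker
  apply Measurable.indicator
  · fun_prop
  · exact measurableSet_lt (by fun_prop) (by fun_prop)

lemma gker_int (t : ℝ) (ht : 0 < t) : Integrable (gker t) (volume : Measure (ℝ × ℝ)) := by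
  rw [Measure.volume_eq_prod, integrable_prod_iff (gker_meas t).aestronglyMeasurable]
  refine ⟨Filter.Eventually.of_forall fun a => (gker_slice t ht a).1, ?_⟩
  simp only [Real.norm_of_nonneg (gker_nonneg t _), (gker_slice t ht _).2]
  rw [integrable_indicator_iff measurableSet_Ioo]
  simp [integrableOn_const_iff]

lemma main_prod (t : ℝ) (ht : 0 < t) (s : ℝ) (hs : s ≠ 0) :
    Integrable (fun p : ℝ × ℝ => ((gker t p : ℝ) : ℂ) *
      Complex.exp (((-(2 * π * (s * p.1)) : ℝ) : ℂ) * Complex.I)) ∧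
    ∫ p : ℝ × ℝ, ((gker t p : ℝ) : ℂ) *
      Complex.exp (((-(2 * π * (s * p.1)) : ℝ) : ℂ) * Complex.I) =
      ((Real.sin (2 * π * t * s) / (2 * π * s) : ℝ) : ℂ) := by
  have hI : Integrable (fun p : ℝ × ℝ => ((gker t p : ℝ) : ℂ) *
      Complex.exp (((-(2 * π * (s * p.1)) : ℝ) : ℂ) * Complex.I)) := by
    refine (gker_int t ht).ofReal.mul_bdd (c := 1) ?_ ?_
    · exact (by fun_prop : Continuous _).aestronglyMeasurable
    · exact Filter.Eventually.of_forall fun p => (Complex.norm_exp_ofReal_mul_I _).le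
  refine ⟨hI, ?_⟩
  rw [Measure.volume_eq_prod] at hI ⊢
  rw [integral_prod _ hI]
  simp only [integral_mul_const, integral_complex_ofReal, (gker_slice t ht _).2]
  have e : (fun a : ℝ => (((Set.Ioo (-t) t).indicator (fun _ => (1 / 2 : ℝ)) a : ℝ) : ℂ) *
      Complex.exp (((-(2 * π * (s * a)) : ℝ) : ℂ) * Complex.I)) =
      (Set.Ioo (-t) t).indicator (fun a : ℝ => (1 / 2 : ℂ) *
        Complex.exp ((-(2 * π * s) * Complex.I : ℂ) * a)) := by
    ext a
    by_cases ha : a ∈ Set.Ioo (-t) t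
    · simp only [Set.indicator_of_mem ha]
      push_cast
      congr 2
      ring
    · simp [Set.indicator_of_notMem ha]
  rw [e, integral_indicator measurableSet_Ioo, integral_const_mul, ← integral_Ioc_eq_integral_Ioo,
    ← intervalIntegral.integral_of_le (by linarith), integral_exp_mul_complex]
  · have h1 : (s : ℂ) ≠ 0 := by exact_mod_cast hs
    have h2 : (π : ℂ) ≠ 0 := by exact_mod_cast Real.pi_ne_zero
    push_cast
    rw [Complex.sin]
    rw [show -(2 * (π : ℂ) * s) * Complex.I * t = -(2 * π * t * s) * Complex.I by ring,
      show -(2 * (π : ℂ) * s) * Complex.I * -t = (2 * π * t * s) * Complex.I by ring]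
    field_simp
    rw [Complex.I_sq]
    ring
  · simp [hs, Real.pi_ne_zero]


/-- Let `t > 0`. For every `ξ ∈ ℝ²` with `ξ ≠ 0`,
`∫_{|x|<t} (1/(2π)) (t² − |x|²)^{−1/2} exp(−2πi⟨ξ,x⟩) dx = sin(2πt|ξ|)/(2π|ξ|)`,
the integral being absolutely convergent. -/
theorem fourier_transform_wave_kernel_dim_two (t : ℝ) (ht : 0 < t)
    (ξ : EuclideanSpace ℝ (Fin 2)) (hξ : ξ ≠ 0) :
    IntegrableOn (fun x : EuclideanSpace ℝ (Fin 2) =>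
        ((1 / (2 * π) * (t ^ 2 - ‖x‖ ^ 2) ^ (-(1 : ℝ) / 2) : ℝ) : ℂ) *
          Complex.exp (((-(2 * π * (inner ℝ ξ x : ℝ)) : ℝ) : ℂ) * Complex.I))
      (Metric.ball (0 : EuclideanSpace ℝ (Fin 2)) t) ∧
    (∫ x in Metric.ball (0 : EuclideanSpace ℝ (Fin 2)) t,
        ((1 / (2 * π) * (t ^ 2 - ‖x‖ ^ 2) ^ (-(1 : ℝ) / 2) : ℝ) : ℂ) *
          Complex.exp (((-(2 * π * (inner ℝ ξ x : ℝ)) : ℝ) : ℂ) * Complex.I)) =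
      ((Real.sin (2 * π * t * ‖ξ‖) / (2 * π * ‖ξ‖) : ℝ) : ℂ) := by
  have hn : ‖ξ‖ ≠ 0 := norm_ne_zero_iff.2 hξ
  obtain ⟨b, hb⟩ := Orthonormal.exists_orthonormalBasis_extension_of_card_eq (𝕜 := ℝ)
    (E := EuclideanSpace ℝ (Fin 2)) (ι := Fin 2) (by simp)
    (v := fun _ => ‖ξ‖⁻¹ • ξ) (s := {0}) (by
      constructor
      · intro i
        simp [norm_smul, hn]
      · intro i j hij
        exact absurd (Subsingleton.elim i j) hij)
  have hb0 : b 0 = ‖ξ‖⁻¹ • ξ := hb 0 rfl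
  let e : EuclideanSpace ℝ (Fin 2) ≃ᵐ ℝ × ℝ :=
    (b.measurableEquiv.trans (MeasurableEquiv.toLp 2 (Fin 2 → ℝ)).symm).trans
      MeasurableEquiv.finTwoArrow
  have he : MeasurePreserving e volume volume :=
    (b.measurePreserving_measurableEquiv.trans
      (EuclideanSpace.volume_preserving_symm_measurableEquiv_toLp (Fin 2))).trans
      (volume_preserving_finTwoArrow ℝ)
  have he1 : ∀ x, (e x).1 = b.repr x 0 := fun x => rfl
  have he2 : ∀ x, (e x).2 = b.repr x 1 := fun x => rfl
  have hnorm : ∀ x, (e x).1 ^ 2 + (e x).2 ^ 2 = ‖x‖ ^ 2 := by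
    intro x
    rw [he1, he2, ← b.repr.norm_map x, EuclideanSpace.norm_sq_eq]
    simp
  have hin : ∀ x, ‖ξ‖ * (e x).1 = inner ℝ ξ x := by
    intro x
    rw [he1, b.repr_apply_apply, hb0, inner_smul_left]
    simp [hn]
  obtain ⟨h1, h2⟩ := main_prod t ht ‖ξ‖ hn
  have hF : (Metric.ball (0 : EuclideanSpace ℝ (Fin 2)) t).indicator
      (fun x : EuclideanSpace ℝ (Fin 2) =>
        ((1 / (2 * π) * (t ^ 2 - ‖x‖ ^ 2) ^ (-(1 : ℝ) / 2) : ℝ) : ℂ) *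
          Complex.exp (((-(2 * π * (inner ℝ ξ x : ℝ)) : ℝ) : ℂ) * Complex.I)) =
      fun x => (fun p : ℝ × ℝ => ((gker t p : ℝ) : ℂ) *
        Complex.exp (((-(2 * π * (‖ξ‖ * p.1)) : ℝ) : ℂ) * Complex.I)) (e x) := by
    ext x
    have hm : e x ∈ {p : ℝ × ℝ | p.1 ^ 2 + p.2 ^ 2 < t ^ 2} ↔ x ∈ Metric.ball 0 t := by
      rw [Set.mem_ofPred_eq, hnorm, mem_ball_zero_iff, sq_lt_sq, abs_of_pos ht, abs_norm]
    simp only [hin]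
    unfold gker
    by_cases hx : x ∈ Metric.ball 0 t
    · rw [Set.indicator_of_mem hx, Set.indicator_of_mem (hm.2 hx), hnorm]
    · rw [Set.indicator_of_notMem hx, Set.indicator_of_notMem (fun h => hx (hm.1 h))]
      simp
  rw [← integrable_indicator_iff measurableSet_ball, ← integral_indicator measurableSet_ball, hF]
  exact ⟨(he.integrable_comp_emb e.measurableEmbedding).2 h1,
    (he.integral_comp e.measurableEmbedding _).trans h2⟩
end

section
/- Let T > 0, let g : [0,T] → [0,∞) be Lebesgue integrable, and let a ≥ 0. Then there exists a finite constant K, depending only on g and T, with the following property: for every bounded measurable function f : [0,T] → [0,∞) satisfying f(t) ≤ a + ∫₀ᵗ f(s) g(t−s) ds for all t ∈ [0,T], one has f(t) ≤ K·a for all t ∈ [0,T]. In particular, if a = 0 then f is identically zero. -/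
open MeasureTheory Set

/-- Gronwall-type lemma with a convolution kernel (Dalang's Lemma 15). Let `T > 0`,
`g : [0,T] → [0,∞)` Lebesgue integrable and `a ≥ 0`. There is a finite constant `K`,
depending only on `g` and `T`, such that every bounded measurable `f : [0,T] → [0,∞)`
with `f(t) ≤ a + ∫₀ᵗ f(s) g(t−s) ds` for all `t ∈ [0,T]` satisfies `f(t) ≤ K·a` on
`[0,T]`; in particular, if `a = 0` then `f ≡ 0`. -/
theorem gronwall_convolution (T : ℝ) (hT : 0 < T) (g : ℝ → ℝ)
    (hg : IntegrableOn g (Icc 0 T)) (hg0 : ∀ t ∈ Icc (0 : ℝ) T, 0 ≤ g t) :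
    ∃ K : ℝ, ∀ a : ℝ, 0 ≤ a → ∀ f : ℝ → ℝ, Measurable f →
      (∀ t ∈ Icc (0 : ℝ) T, 0 ≤ f t) →
      (∃ M : ℝ, ∀ t ∈ Icc (0 : ℝ) T, f t ≤ M) →
      (∀ t ∈ Icc (0 : ℝ) T, f t ≤ a + ∫ s in Ioc (0 : ℝ) t, f s * g (t - s)) →
      (∀ t ∈ Icc (0 : ℝ) T, f t ≤ K * a) ∧
      (a = 0 → ∀ t ∈ Icc (0 : ℝ) T, f t = 0) := by
  have hgI : IntegrableOn g (Ioc 0 T) := hg.mono_set Ioc_subset_Icc_self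
  have hbd : ∀ n : ℕ, ∀ᵐ u ∂(volume.restrict (Ioc 0 T)),
      ‖Real.exp (-(n : ℝ) * u) * g u‖ ≤ ‖g u‖ := by
    intro n
    filter_upwards [ae_restrict_mem measurableSet_Ioc] with u hu
    rw [norm_mul, Real.norm_eq_abs, abs_of_pos (Real.exp_pos _)]
    have h1 : Real.exp (-(n : ℝ) * u) ≤ 1 := by
      apply Real.exp_le_one_iff.2
      have : 0 ≤ (n : ℝ) * u := mul_nonneg n.cast_nonneg hu.1.le
      linarith
    exact mul_le_of_le_one_left (norm_nonneg _) h1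
  have hmeas : ∀ n : ℕ, AEStronglyMeasurable (fun u => Real.exp (-(n : ℝ) * u) * g u)
      (volume.restrict (Ioc 0 T)) := by
    intro n
    exact (by fun_prop : Continuous fun u : ℝ => Real.exp (-(n : ℝ) * u)).aestronglyMeasurable.mul
      hgI.aestronglyMeasurable
  have hlim : Filter.Tendsto (fun n : ℕ => ∫ u in Ioc 0 T, Real.exp (-(n : ℝ) * u) * g u)
      Filter.atTop (nhds (∫ u in Ioc 0 T, (0 : ℝ))) := by
    refine tendsto_integral_of_dominated_convergence (fun u => ‖g u‖) hmeas hgI.norm hbd ?_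
    filter_upwards [ae_restrict_mem measurableSet_Ioc] with u hu
    have h1 : Filter.Tendsto (fun n : ℕ => Real.exp (-(n : ℝ) * u)) Filter.atTop (nhds 0) := by
      have h2 : Filter.Tendsto (fun n : ℕ => (n : ℝ) * u) Filter.atTop Filter.atTop :=
        tendsto_natCast_atTop_atTop.atTop_mul_const hu.1
      simpa [Function.comp_def] using Real.tendsto_exp_neg_atTop_nhds_zero.comp h2
    simpa using h1.mul_const (g u)
  rw [integral_zero] at hlim
  obtain ⟨n, hn⟩ := (hlim.eventually (gt_mem_nhds (show (0 : ℝ) < 1 / 2 by norm_num))).exists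
  have hhI : IntegrableOn (fun u => Real.exp (-(n : ℝ) * u) * g u) (Ioc 0 T) :=
    Integrable.mono hgI (hmeas n) (hbd n)
  generalize (n : ℝ) = c at hn hhI
  clear hlim hmeas hbd
  have key : ∀ a : ℝ, 0 ≤ a → ∀ f : ℝ → ℝ, Measurable f →
      (∀ t ∈ Icc (0 : ℝ) T, 0 ≤ f t) →
      (∃ M : ℝ, ∀ t ∈ Icc (0 : ℝ) T, f t ≤ M) →
      (∀ t ∈ Icc (0 : ℝ) T, f t ≤ a + ∫ s in Ioc (0 : ℝ) t, f s * g (t - s)) →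
      (∀ t ∈ Icc (0 : ℝ) T, f t ≤ (2 * Real.exp (|c| * T) * Real.exp (|c| * T)) * a) := by
    intro a ha f _ hf0 ⟨M, hM⟩ hf
    set E := Real.exp (|c| * T) with hE
    have hexp : ∀ d : ℝ, |d| = |c| → ∀ t ∈ Icc (0 : ℝ) T, Real.exp (d * t) ≤ E := by
      intro d hd t ht
      apply Real.exp_le_exp.2
      rw [← hd]
      exact mul_le_mul (le_abs_self d) ht.2 ht.1 (abs_nonneg d)
    have hM0 : 0 ≤ M := (hf0 0 ⟨le_rfl, hT.le⟩).trans (hM 0 ⟨le_rfl, hT.le⟩)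
    set F : ℝ → ℝ := fun t => Real.exp (-c * t) * f t with hF
    have hFb : BddAbove (F '' Icc 0 T) := by
      refine ⟨E * M, ?_⟩
      rintro _ ⟨t, ht, rfl⟩
      exact mul_le_mul (hexp (-c) (abs_neg c) t ht) (hM t ht) (hf0 t ht) (Real.exp_pos _).le
    have hne : (F '' Icc 0 T).Nonempty := ⟨F 0, 0, ⟨le_rfl, hT.le⟩, rfl⟩
    set B := sSup (F '' Icc 0 T) with hB
    have hFB : ∀ t ∈ Icc (0 : ℝ) T, F t ≤ B := fun t ht => le_csSup hFb ⟨t, ht, rfl⟩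
    have hB0 : 0 ≤ B := le_trans
      (mul_nonneg (Real.exp_pos _).le (hf0 0 ⟨le_rfl, hT.le⟩)) (hFB 0 ⟨le_rfl, hT.le⟩)
    have hfF : ∀ t, f t = Real.exp (c * t) * F t := by
      intro t
      rw [hF]
      simp only
      rw [← mul_assoc, ← Real.exp_add]
      simp
    have hstep : ∀ t ∈ Icc (0 : ℝ) T, F t ≤ E * a + B * (1 / 2) := by
      intro t ht
      have hht : IntervalIntegrable (fun u => Real.exp (-c * u) * g u) volume 0 t :=
        (intervalIntegrable_iff_integrableOn_Ioc_of_le ht.1).2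
          (hhI.mono_set (Ioc_subset_Ioc_right ht.2))
      have hsI : IntegrableOn (fun s => Real.exp (-c * (t - s)) * g (t - s)) (Ioc 0 t) := by
        have := (hht.comp_sub_left t).symm
        rw [sub_zero, sub_self] at this
        exact (intervalIntegrable_iff_integrableOn_Ioc_of_le ht.1).1 this
      have h1 : ∫ s in Ioc (0 : ℝ) t, f s * g (t - s) ≤
          ∫ s in Ioc (0 : ℝ) t, (Real.exp (c * t) * B) *
            (Real.exp (-c * (t - s)) * g (t - s)) := by
        apply integral_mono_of_nonneg
        · filter_upwards [ae_restrict_mem measurableSet_Ioc] with s hs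
          exact mul_nonneg (hf0 s ⟨hs.1.le, hs.2.trans ht.2⟩)
            (hg0 _ ⟨by linarith [hs.2], by linarith [hs.1, ht.2]⟩)
        · exact hsI.const_mul _
        · filter_upwards [ae_restrict_mem measurableSet_Ioc] with s hs
          have e1 : Real.exp (c * t) * Real.exp (-c * (t - s)) = Real.exp (c * s) := by
            rw [← Real.exp_add]; congr 1; ring
          have e2 : (Real.exp (c * t) * B) * (Real.exp (-c * (t - s)) * g (t - s)) =
              (Real.exp (c * s) * B) * g (t - s) := by rw [← e1]; ring
          simp only [e2]
          rw [hfF s]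
          exact mul_le_mul_of_nonneg_right
            (mul_le_mul_of_nonneg_left (hFB s ⟨hs.1.le, hs.2.trans ht.2⟩) (Real.exp_pos _).le)
            (hg0 _ ⟨by linarith [hs.2], by linarith [hs.1, ht.2]⟩)
      have h2 : ∫ s in Ioc (0 : ℝ) t, Real.exp (-c * (t - s)) * g (t - s) ≤ 1 / 2 := by
        rw [← intervalIntegral.integral_of_le ht.1,
          intervalIntegral.integral_comp_sub_left (fun u => Real.exp (-c * u) * g u) t,
          sub_self, sub_zero, intervalIntegral.integral_of_le ht.1]
        refine le_trans (setIntegral_mono_set hhI ?_ ?_) hn.le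
        · filter_upwards [ae_restrict_mem measurableSet_Ioc] with u hu
          exact mul_nonneg (Real.exp_pos _).le (hg0 u ⟨hu.1.le, hu.2⟩)
        · exact (Ioc_subset_Ioc_right ht.2).eventuallyLE
      rw [integral_const_mul] at h1
      have h3 := hf t ht
      have h4 : f t ≤ a + Real.exp (c * t) * B * (1 / 2) :=
        h3.trans (add_le_add le_rfl (h1.trans
          (mul_le_mul_of_nonneg_left h2 (mul_nonneg (Real.exp_pos _).le hB0))))
      have h5 := mul_le_mul_of_nonneg_left h4 (Real.exp_pos (-c * t)).le
      have e3 : Real.exp (-c * t) * Real.exp (c * t) = 1 := by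
        rw [← Real.exp_add]; simp
      have h6 : Real.exp (-c * t) * a ≤ E * a :=
        mul_le_mul_of_nonneg_right (hexp (-c) (abs_neg c) t ht) ha
      calc F t ≤ Real.exp (-c * t) * (a + Real.exp (c * t) * B * (1 / 2)) := h5
        _ = Real.exp (-c * t) * a + (Real.exp (-c * t) * Real.exp (c * t)) * B * (1 / 2) := by
          ring
        _ ≤ _ := by rw [e3]; linarith
    have hBB : B ≤ E * a + B * (1 / 2) := by
      apply csSup_le hne
      rintro _ ⟨t, ht, rfl⟩
      exact hstep t ht
    intro t ht
    rw [hfF t]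
    have h7 : F t ≤ 2 * E * a := (hFB t ht).trans (by linarith)
    calc Real.exp (c * t) * F t ≤ E * (2 * E * a) :=
          mul_le_mul (hexp c rfl t ht) h7 (mul_nonneg (Real.exp_pos _).le (hf0 t ht))
            (Real.exp_pos _).le
      _ = _ := by ring
  refine ⟨_, fun a ha f hfm hf0 hM hf => ⟨key a ha f hfm hf0 hM hf, ?_⟩⟩
  intro h0 t ht
  have := key a ha f hfm hf0 hM hf t ht
  rw [h0, mul_zero] at this
  exact le_antisymm this (hf0 t ht)
end
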